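/- Fix a positive integer d, ordered partitions μ = (μ₁,…,μ_m) and ν = (ν₁,…,ν_n) of d, and nonnegative integers p, q, r with p = 0 or q = 0 and p + q + r = 2g − 2 + m + n for some nonnegative integer g; set b = p + q + r. Let F be the number of tuples (σ₁, (A₁,…,A_m), τ₁,…,τ_b, σ₂, (B₁,…,B_n)) where σ₁, σ₂ ∈ S_d, each τ_i is a transposition, (τ₁,…,τ_b) satisfies the (p,q)-monotonicity condition, σ₂·τ_b⋯τ₁·σ₁ = id, the subgroup generated by σ₁, τ₁,…,τ_b, σ₂ acts transitively on {1,…,d}, (A₁,…,A_m) is an ordered list of the orbits of σ₁ with |A_i| = μ_i, and (B₁,…,B_n) is an ordered list of the orbits of σ₂ with |B_j| = ν_j. Then F = (d!/(μ₁⋯μ_m)) · M_{p,q,r;μ,ν}. -/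

import Mathlib

/-- The larger moved point of a transposition (as a natural number):
the supremum of the values in its support. -/
def permTop {d : ℕ} (τ : Equiv.Perm (Fin d)) : ℕ := τ.support.sup Fin.val

/-- The `(p,q)`-monotonicity condition on a tuple `(τ₁,…,τ_b)` of transpositions
(indexed here by `Fin b`, with index `i` corresponding to `τ_{i+1}`):
`top τ_k ≤ top τ_{k+1}` for `1 ≤ k ≤ p-1` and `top τ_k < top τ_{k+1}` for `p ≤ k ≤ p+q-1`. -/
def MonCond {d b : ℕ} (p q : ℕ) (τ : Fin b → Equiv.Perm (Fin d)) : Prop :=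
  ∀ i j : Fin b, (j : ℕ) = (i : ℕ) + 1 →
    ((i : ℕ) + 1 < p → permTop (τ i) ≤ permTop (τ j)) ∧
    (p ≤ (i : ℕ) + 1 → (i : ℕ) + 1 < p + q → permTop (τ i) < permTop (τ j))

/-- The partial sum `μ₁ + ⋯ + μ_j` of an ordered partition. -/
def partialSum {m : ℕ} (μ : Fin m → ℕ) (j : ℕ) : ℕ :=
  ∑ i : Fin m, if (i : ℕ) < j then μ i else 0

/-- `σ` is the permutation `σ_μ` whose cycles are the consecutive blocks
`(1 … μ₁)(μ₁+1 … μ₁+μ₂)⋯`: inside a block it sends `k` to `k+1`, and it sends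
the last element of each block back to the first element of that block.
(Here elements of `{1,…,d}` are represented 0-indexed by `Fin d`.) -/
def IsBlockCyclePerm {d m : ℕ} (μ : Fin m → ℕ) (σ : Equiv.Perm (Fin d)) : Prop :=
  (∀ k : Fin d, ∀ j : Fin m, partialSum μ j ≤ (k : ℕ) →
      (k : ℕ) + 1 < partialSum μ ((j : ℕ) + 1) → ((σ k : Fin d) : ℕ) = (k : ℕ) + 1) ∧
  (∀ k : Fin d, ∀ j : Fin m, (k : ℕ) + 1 = partialSum μ ((j : ℕ) + 1) →
      ((σ k : Fin d) : ℕ) = partialSum μ (j : ℕ))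

/-- `B` is an ordered list of the orbits of `σ` on `{1,…,d}` with `|B_j| = ν_j`:
each `B_j` is an orbit (i.e. a cycle, possibly a fixed point), the `B_j` are
pairwise distinct, every point lies in some `B_j`, and `B_j` has `ν_j` elements. -/
def IsOrbitListing {d n : ℕ} (σ : Equiv.Perm (Fin d)) (ν : Fin n → ℕ)
    (B : Fin n → Set (Fin d)) : Prop :=
  (∀ j, ∃ x : Fin d, B j = {y | σ.SameCycle x y}) ∧
  Function.Injective B ∧
  (∀ x : Fin d, ∃ j, x ∈ B j) ∧
  (∀ j, (B j).ncard = ν j)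

/-- `M_{p,q,r;μ,ν}`: the number of tuples `(τ₁,…,τ_b, σ₂, (B₁,…,B_n))` where each
`τᵢ` is a transposition, `(τ₁,…,τ_b)` satisfies the `(p,q)`-monotonicity condition,
`σ₂·τ_b⋯τ₁·σ_μ = id`, the subgroup generated by `σ_μ, τ₁,…,τ_b, σ₂` acts transitively
on `{1,…,d}`, and `(B₁,…,B_n)` is an ordered list of the orbits of `σ₂` with
`|B_j| = ν_j`.  Here `σμ` is the block-cycle permutation `σ_μ`. -/
noncomputable def Mcount (d n p q r : ℕ) (ν : Fin n → ℕ) (σμ : Equiv.Perm (Fin d)) : ℕ :=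
  Nat.card { t : (Fin (p + q + r) → Equiv.Perm (Fin d)) × Equiv.Perm (Fin d) ×
      (Fin n → Set (Fin d)) //
    (∀ i, (t.1 i).IsSwap) ∧ MonCond p q t.1 ∧
    t.2.1 * (List.ofFn t.1).reverse.prod * σμ = 1 ∧
    (∀ x y : Fin d, ∃ g ∈ Subgroup.closure
        ({σμ, t.2.1} ∪ Set.range t.1 : Set (Equiv.Perm (Fin d))), g x = y) ∧
    IsOrbitListing t.2.1 ν t.2.2 }

open scoped Classical in
noncomputable def cls (d n : ℕ) : Finset (Equiv.Perm (Fin d)) :=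
  Finset.univ.filter fun x => x.IsSwap ∧ permTop x = n

noncomputable def JM {d : ℕ} {A : Type*} [Ring A] (ι : Equiv.Perm (Fin d) → A) (n : ℕ) : A :=
  ∑ x ∈ cls d n, ι x

open scoped Classical in
noncomputable def wsum {d b : ℕ} {A : Type*} [Ring A] (ι : Equiv.Perm (Fin d) → A)
    (Q : (Fin b → Equiv.Perm (Fin d)) → Prop) : A :=
  ∑ τ : Fin b → Equiv.Perm (Fin d), if Q τ then (List.ofFn fun i => ι (τ i)).reverse.prod else 0

theorem mem_cls {d n : ℕ} {x : Equiv.Perm (Fin d)} : x ∈ cls d n ↔ x.IsSwap ∧ permTop x = n := by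
  simp [cls]

theorem isSwap_conj {d : ℕ} (g x : Equiv.Perm (Fin d)) (hx : x.IsSwap) :
    (g * x * g⁻¹).IsSwap := by
  obtain ⟨a, b, hab, rfl⟩ := hx
  refine ⟨g a, g b, fun h => hab (g.injective h), ?_⟩
  rw [Equiv.swap_apply_apply]

theorem permTop_conj {d : ℕ} (g x : Equiv.Perm (Fin d)) :
    permTop (g * x * g⁻¹) = x.support.sup (fun a => (g a : ℕ)) := by
  rw [permTop, Equiv.Perm.support_conj, Finset.sup_map]; rfl

theorem permTop_swap {d : ℕ} {a b : Fin d} (h : a < b) : permTop (Equiv.swap a b) = b := by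
  rw [permTop, Equiv.Perm.support_swap h.ne]
  simp only [Finset.sup_insert, Finset.sup_singleton]
  exact sup_eq_right.2 (le_of_lt h)

theorem isSwap_iff {d : ℕ} {x : Equiv.Perm (Fin d)} (hx : x.IsSwap) :
    ∃ a b : Fin d, a < b ∧ x = Equiv.swap a b ∧ permTop x = b := by
  obtain ⟨a, b, hab, rfl⟩ := hx
  rcases lt_or_gt_of_ne hab with h | h
  · exact ⟨a, b, h, rfl, permTop_swap h⟩
  · exact ⟨b, a, h, Equiv.swap_comm _ _, by rw [Equiv.swap_comm, permTop_swap h]⟩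

theorem permTop_lt {d : ℕ} {x : Equiv.Perm (Fin d)} (hx : x.IsSwap) : permTop x < d := by
  obtain ⟨a, b, -, -, h⟩ := isSwap_iff hx
  rw [h]; exact b.2

/-- conjugation of the class. -/
theorem sum_conj {d n n' : ℕ} {A : Type*} [Ring A] (ι : Equiv.Perm (Fin d) → A)
    (g : Equiv.Perm (Fin d))
    (h1 : ∀ x ∈ cls d n, g * x * g⁻¹ ∈ cls d n')
    (h2 : ∀ x ∈ cls d n', g⁻¹ * x * g ∈ cls d n) :
    ∑ x ∈ cls d n, ι (g * x * g⁻¹) = JM ι n' := by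
  refine Finset.sum_bij' (fun x _ => g * x * g⁻¹) (fun x _ => g⁻¹ * x * g) h1 h2 ?_ ?_ ?_
  · intros; group
  · intros; group
  · intros; rfl

theorem cls_conj_of {d n : ℕ} (g : Equiv.Perm (Fin d))
    (hg : ∀ a b : Fin d, a < b → (b : ℕ) = n → ((g a : ℕ) < n ∧ (g b : ℕ) = n)) :
    ∀ x ∈ cls d n, g * x * g⁻¹ ∈ cls d n := by
  intro x hx
  rw [mem_cls] at hx ⊢
  refine ⟨isSwap_conj _ _ hx.1, ?_⟩
  obtain ⟨a, b, hab, rfl, hb⟩ := isSwap_iff hx.1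
  have := hg a b hab (by omega)
  rw [← Equiv.swap_apply_apply, permTop_swap (by rw [Fin.lt_def]; omega), this.2]

/-- `J n` commutes with `ι y` when `y` fixes everything from `n` on. -/
theorem JM_comm_ι {d n : ℕ} {A : Type*} [Ring A] (ι : Equiv.Perm (Fin d) → A)
    (hι : ∀ x y, ι x * ι y = ι (x * y * x⁻¹) * ι x) (y : Equiv.Perm (Fin d))
    (hy : y.IsSwap) (hn : permTop y < n) : ι y * JM ι n = JM ι n * ι y := by
  have key : ∀ x ∈ cls d n, y * x * y⁻¹ ∈ cls d n := by
    apply cls_conj_of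
    intro a b hab hb
    obtain ⟨u, v, huv, rfl, hv⟩ := isSwap_iff hy
    rw [Fin.lt_def] at *
    simp only [Equiv.swap_apply_def]
    refine ⟨?_, ?_⟩ <;> split_ifs <;> simp_all <;> omega
  have hyy : y⁻¹ = y := by
    obtain ⟨u, v, huv, rfl⟩ := hy; simp
  calc ι y * JM ι n = (∑ x ∈ cls d n, ι (y * x * y⁻¹)) * ι y := by
        simp only [JM, Finset.mul_sum, Finset.sum_mul, hι y]
    _ = JM ι n * ι y := by
        rw [sum_conj ι y key]
        intro x hx
        have := key x hx
        rw [hyy] at this ⊢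
        exact this

theorem JM_comm {d m n : ℕ} {A : Type*} [Ring A] (ι : Equiv.Perm (Fin d) → A)
    (hι : ∀ x y, ι x * ι y = ι (x * y * x⁻¹) * ι x) (hmn : m < n) :
    JM ι m * JM ι n = JM ι n * JM ι m := by
  conv_lhs => rw [JM, Finset.sum_mul]
  conv_rhs => rw [JM.eq_1 ι m, Finset.mul_sum]
  refine Finset.sum_congr rfl fun y hy => ?_
  rw [mem_cls] at hy
  exact JM_comm_ι ι hι y hy.1 (by omega)

section adj
variable {d : ℕ} {A : Type*} [Ring A] (ι : Equiv.Perm (Fin d) → A)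
  (hι : ∀ x y, ι x * ι y = ι (x * y * x⁻¹) * ι x) (k l : Fin d) (hkl : (l : ℕ) = k + 1)
  (φ : A →+* A) (hφ : ∀ x, φ (ι x) = ι (Equiv.swap k l * x * (Equiv.swap k l)⁻¹))
include hkl hφ

theorem φ_JM_other (n : ℕ) (h1 : n ≠ k) (h2 : n ≠ l) : φ (JM ι n) = JM ι n := by
  have key : ∀ x ∈ cls d n, Equiv.swap k l * x * (Equiv.swap k l)⁻¹ ∈ cls d n := by
    apply cls_conj_of
    intro a b hab hb
    rw [Fin.lt_def] at *
    simp only [Equiv.swap_apply_def]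
    refine ⟨?_, ?_⟩ <;> split_ifs <;> simp_all <;> omega
  rw [JM, map_sum]
  simp only [hφ]
  rw [sum_conj ι _ key]
  · rfl
  intro x hx
  have := key x hx
  rw [Equiv.swap_inv] at this ⊢
  exact this

theorem JM_succ : JM ι l = φ (JM ι k) + ι (Equiv.swap k l) := by
  have hlt : k < l := by rw [Fin.lt_def]; omega
  have hs : Equiv.swap k l ∈ cls d l := mem_cls.2 ⟨⟨k, l, hlt.ne, rfl⟩, permTop_swap hlt⟩
  rw [JM.eq_1 ι l, ← Finset.sum_erase_add _ _ hs, JM, map_sum]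
  congr 1
  simp only [hφ]
  symm
  refine Finset.sum_bij' (fun x _ => Equiv.swap k l * x * (Equiv.swap k l)⁻¹)
    (fun x _ => (Equiv.swap k l)⁻¹ * x * Equiv.swap k l) ?_ ?_ ?_ ?_ ?_
  · intro x hx
    rw [mem_cls] at hx
    obtain ⟨a, b, hab, rfl, hb⟩ := isSwap_iff hx.1
    obtain rfl : b = k := Fin.ext (by omega)
    have hal : a < l := hab.trans hlt
    have e : Equiv.swap b l * Equiv.swap a b * (Equiv.swap b l)⁻¹ = Equiv.swap a l := by
      rw [← Equiv.swap_apply_apply, Equiv.swap_apply_left, Equiv.swap_apply_of_ne_of_ne hab.ne hal.ne]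
    rw [e, Finset.mem_erase, mem_cls]
    refine ⟨fun h => ?_, ⟨a, l, hal.ne, rfl⟩, permTop_swap hal⟩
    have := congrArg (fun f => f l) h
    simp at this
    exact hab.ne this
  · intro x hx
    rw [Finset.mem_erase, mem_cls] at hx
    obtain ⟨hne, hx⟩ := hx
    obtain ⟨a, b, hab, rfl, hb⟩ := isSwap_iff hx.1
    obtain rfl : b = l := Fin.ext (by omega)
    have hak : a < k := by
      rw [Fin.lt_def] at *
      have : a ≠ k := by rintro rfl; exact hne rfl
      have : (a : ℕ) ≠ k := fun h => this (Fin.ext h)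
      omega
    have e : (Equiv.swap k b)⁻¹ * Equiv.swap a b * (Equiv.swap k b) = Equiv.swap a k := by
      have := Equiv.swap_apply_apply (Equiv.swap k b) a b
      rw [Equiv.swap_apply_right, Equiv.swap_apply_of_ne_of_ne hak.ne hab.ne] at this
      rw [this]; simp
    rw [e, mem_cls]
    exact ⟨⟨a, k, hak.ne, rfl⟩, permTop_swap hak⟩
  · intros; group
  · intros; group
  · intros; rfl

theorem φφ_JM (n : ℕ) : φ (φ (JM ι n)) = JM ι n := by
  simp only [JM, map_sum, hφ]
  refine Finset.sum_congr rfl fun x _ => ?_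
  congr 1
  simp only [Equiv.swap_inv]
  have := Equiv.swap_mul_self k l
  calc _ = (Equiv.swap k l * Equiv.swap k l) * x * (Equiv.swap k l * Equiv.swap k l) := by group
    _ = x := by rw [this]; simp

theorem φ_ιs : φ (ι (Equiv.swap k l)) = ι (Equiv.swap k l) := by
  rw [hφ]; simp

theorem φ_JM_add : φ (JM ι k + JM ι l) = JM ι k + JM ι l := by
  rw [JM_succ ι k l hkl φ hφ, map_add, map_add, φφ_JM ι k l hkl φ hφ, φ_ιs ι k l hkl φ hφ]
  abel

include hι in
theorem φ_JM_mul : φ (JM ι k * JM ι l) = JM ι k * JM ι l := by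
  have hlt : k < l := by rw [Fin.lt_def]; omega
  have h1 : ι (Equiv.swap k l) * JM ι k = φ (JM ι k) * ι (Equiv.swap k l) := by
    simp only [JM, map_sum, hφ, Finset.mul_sum, Finset.sum_mul]
    exact Finset.sum_congr rfl fun x _ => hι _ _
  have h2 : JM ι l = φ (JM ι k) + ι (Equiv.swap k l) := JM_succ ι k l hkl φ hφ
  have h3 : φ (JM ι l) = JM ι k + ι (Equiv.swap k l) := by
    rw [h2, map_add, φφ_JM ι k l hkl φ hφ, φ_ιs ι k l hkl φ hφ]
  rw [JM_comm ι hι (Fin.lt_def.1 hlt), ← JM_comm ι hι (Fin.lt_def.1 hlt), map_mul, h3,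
    JM_comm ι hι (Fin.lt_def.1 hlt), h2, mul_add, add_mul, h1]
end adj
section rec
variable {d : ℕ} {A : Type*} [Ring A] (ι : Equiv.Perm (Fin d) → A)

theorem wsum_congr {b : ℕ} {Q Q' : (Fin b → Equiv.Perm (Fin d)) → Prop} (h : ∀ τ, Q τ ↔ Q' τ) :
    wsum ι Q = wsum ι Q' := by
  have : Q = Q' := funext fun τ => propext (h τ)
  rw [this]

theorem wsum_false {b : ℕ} {Q : (Fin b → Equiv.Perm (Fin d)) → Prop} (h : ∀ τ, ¬ Q τ) :
    wsum ι Q = 0 := by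
  simp [wsum, h]

theorem wsum_zero {Q : (Fin 0 → Equiv.Perm (Fin d)) → Prop} (h : ∀ τ, Q τ) :
    wsum ι Q = 1 := by
  simp [wsum, h]

theorem wsum_succ {b : ℕ} (Q : (Fin (b + 1) → Equiv.Perm (Fin d)) → Prop) :
    wsum ι Q = ∑ x, ι x * wsum ι (fun τ : Fin b → Equiv.Perm (Fin d) =>
      Q (Fin.snoc (α := fun _ => Equiv.Perm (Fin d)) τ x)) := by
  classical
  unfold wsum
  rw [← Equiv.sum_comp (Fin.snocEquiv (fun _ => Equiv.Perm (Fin d))), Fintype.sum_prod_type]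
  refine Finset.sum_congr rfl fun x _ => ?_
  rw [Finset.mul_sum]
  refine Finset.sum_congr rfl fun τ _ => ?_
  simp only [Fin.snocEquiv, Equiv.coe_fn_mk, mul_ite, mul_zero]
  congr 1
  rw [List.ofFn_succ']
  simp

def QW (n b : ℕ) (τ : Fin b → Equiv.Perm (Fin d)) : Prop :=
  (∀ i, (τ i).IsSwap) ∧ Monotone (fun i => permTop (τ i)) ∧ ∀ i, permTop (τ i) < n

def QS (n b : ℕ) (τ : Fin b → Equiv.Perm (Fin d)) : Prop :=
  (∀ i, (τ i).IsSwap) ∧ StrictMono (fun i => permTop (τ i)) ∧ ∀ i, permTop (τ i) < n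

theorem QW_snoc (n b : ℕ) (τ : Fin b → Equiv.Perm (Fin d)) (x : Equiv.Perm (Fin d)) :
    QW n (b + 1) (Fin.snoc (α := fun _ => Equiv.Perm (Fin d)) τ x) ↔
      x.IsSwap ∧ permTop x < n ∧ QW (permTop x + 1) b τ := by
  constructor
  · rintro ⟨h1, h2, h3⟩
    refine ⟨by simpa using h1 (Fin.last b), by simpa using h3 (Fin.last b),
      fun i => by simpa using h1 i.castSucc, fun i j hij => ?_, fun i => ?_⟩
    · simpa using h2 (Fin.castSucc_le_castSucc_iff.2 hij)
    · have := h2 (Fin.le_last i.castSucc)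
      simp at this
      omega
  · rintro ⟨h1, h2, h3, h4, h5⟩
    refine ⟨fun i => ?_, fun i j hij => ?_, fun i => ?_⟩
    · induction i using Fin.lastCases <;> simp [h1, h3]
    · induction i using Fin.lastCases with
      | last => 
        obtain rfl : j = Fin.last b := by simpa using hij
        exact le_rfl
      | cast i =>
        induction j using Fin.lastCases with
        | last => simpa using Nat.lt_succ_iff.1 (h5 i)
        | cast j => simpa using h4 (Fin.castSucc_le_castSucc_iff.1 hij)
    · induction i using Fin.lastCases with
      | last => simpa using h2
      | cast i => have := h5 i; simp; omega

theorem QS_snoc (n b : ℕ) (τ : Fin b → Equiv.Perm (Fin d)) (x : Equiv.Perm (Fin d)) :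
    QS n (b + 1) (Fin.snoc (α := fun _ => Equiv.Perm (Fin d)) τ x) ↔
      x.IsSwap ∧ permTop x < n ∧ QS (permTop x) b τ := by
  constructor
  · rintro ⟨h1, h2, h3⟩
    refine ⟨by simpa using h1 (Fin.last b), by simpa using h3 (Fin.last b),
      fun i => by simpa using h1 i.castSucc, fun i j hij => ?_, fun i => ?_⟩
    · simpa using h2 (Fin.castSucc_lt_castSucc_iff.2 hij)
    · simpa using h2 (Fin.castSucc_lt_last i)
  · rintro ⟨h1, h2, h3, h4, h5⟩
    refine ⟨fun i => ?_, fun i j hij => ?_, fun i => ?_⟩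
    · induction i using Fin.lastCases <;> simp [h1, h3]
    · induction i using Fin.lastCases with
      | last => exact absurd hij (Fin.le_last j).not_gt
      | cast i =>
        induction j using Fin.lastCases with
        | last => simpa using (h5 i)
        | cast j => simpa using h4 (Fin.castSucc_lt_castSucc_iff.1 hij)
    · induction i using Fin.lastCases with
      | last => simpa using h2
      | cast i => have := h5 i; simp; omega

theorem wsum_rec {b : ℕ} (n : ℕ) (Q : ℕ → (Fin (b + 1) → Equiv.Perm (Fin d)) → Prop)
    (Q' : ℕ → (Fin b → Equiv.Perm (Fin d)) → Prop)
    (h : ∀ n τ x, Q n (Fin.snoc (α := fun _ => Equiv.Perm (Fin d)) τ x) ↔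
      x.IsSwap ∧ permTop x < n ∧ Q' (permTop x) τ) :
    wsum ι (Q (n + 1)) = wsum ι (Q n) + JM ι n * wsum ι (Q' n) := by
  classical
  rw [wsum_succ, wsum_succ, JM, cls, Finset.sum_filter, Finset.sum_mul, ← Finset.sum_add_distrib]
  refine Finset.sum_congr rfl fun x _ => ?_
  by_cases hx : x.IsSwap ∧ permTop x = n
  · rw [if_pos hx, wsum_congr ι (Q' := Q' n), wsum_false ι (b := b) (Q := fun τ => Q n _)]
    · simp
    · intro τ; rw [h]; have := hx.2; omega
    · intro τ; rw [h, hx.2]; simp [hx.1]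
  · rw [if_neg hx, zero_mul, add_zero]
    congr 1
    refine wsum_congr ι ?_
    · intro τ; rw [h, h]
      constructor
      · rintro ⟨h1, h2, h3⟩; exact ⟨h1, by have : permTop x ≠ n := fun e => hx ⟨h1, e⟩
                                           omega, h3⟩
      · rintro ⟨h1, h2, h3⟩; exact ⟨h1, by omega, h3⟩

theorem QW_rec (n b : ℕ) : wsum ι (QW (n + 1) (b + 1)) =
    wsum ι (QW n (b + 1)) + JM ι n * wsum ι (QW (n + 1) b) :=
  wsum_rec ι n (fun n => QW n (b + 1)) (fun n => QW (n + 1) b) (fun n => QW_snoc n b)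

theorem QS_rec (n b : ℕ) : wsum ι (QS (n + 1) (b + 1)) =
    wsum ι (QS n (b + 1)) + JM ι n * wsum ι (QS n b) :=
  wsum_rec ι n (fun n => QS n (b + 1)) (fun n => QS n b) (fun n => QS_snoc n b)

theorem QW_zero (n : ℕ) : wsum ι (QW n 0) = 1 :=
  wsum_zero ι fun _ => ⟨fun i => i.elim0, fun i => i.elim0, fun i => i.elim0⟩
theorem QS_zero (n : ℕ) : wsum ι (QS n 0) = 1 :=
  wsum_zero ι fun _ => ⟨fun i => i.elim0, fun i => i.elim0, fun i => i.elim0⟩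
theorem QW_zero' (b : ℕ) : wsum ι (QW 0 (b + 1)) = 0 :=
  wsum_false ι fun τ h => by have := h.2.2 0; omega
theorem QS_zero' (b : ℕ) : wsum ι (QS 0 (b + 1)) = 0 :=
  wsum_false ι fun τ h => by have := h.2.2 0; omega

variable (hι : ∀ x y, ι x * ι y = ι (x * y * x⁻¹) * ι x) (k l : Fin d) (hkl : (l : ℕ) = k + 1)
  (φ : A →+* A) (hφ : ∀ x, φ (ι x) = ι (Equiv.swap k l * x * (Equiv.swap k l)⁻¹))
include hι hkl hφ

theorem φ_QS (n b : ℕ) (hn : n ≠ l) : φ (wsum ι (QS n b)) = wsum ι (QS n b) := by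
  induction n using Nat.strong_induction_on generalizing b with
  | _ n ih =>
  rcases b with _ | b
  · simp [QS_zero]
  rcases n with _ | n
  · simp [QS_zero']
  by_cases h : n = l
  · have hs := φ_JM_add ι k l hkl φ hφ
    have hm := φ_JM_mul ι hι k l hkl φ hφ
    have hk1 : (k : ℕ) < l := by omega
    rw [JM_comm ι hι hk1] at hm
    subst h
    have i1 := fun b => ih k (by omega) b (by omega)
    rw [QS_rec, hkl, QS_rec]
    rcases b with _ | b
    · rw [QS_zero, QS_zero, ← hkl, add_assoc, mul_one, mul_one, map_add, hs, i1]
    · rw [QS_rec, ← hkl]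
      have : wsum ι (QS k (b + 1 + 1)) + JM ι k * wsum ι (QS k (b + 1)) +
        JM ι l * (wsum ι (QS k (b + 1)) + JM ι k * wsum ι (QS k b)) =
        wsum ι (QS k (b + 1 + 1)) + (JM ι k + JM ι l) * wsum ι (QS k (b + 1)) +
          (JM ι l * JM ι k) * wsum ι (QS k b) := by noncomm_ring
      rw [this, map_add, map_add, map_mul _ (_ + _), map_mul _ (_ * _), hs, hm, i1, i1, i1]
  · rw [QS_rec, map_add, map_mul, ih n (by omega) _ h, ih n (by omega) _ h,
      φ_JM_other ι k l hkl φ hφ n (by omega) h]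

theorem φ_QW (n b : ℕ) (hn : n ≠ l) : φ (wsum ι (QW n b)) = wsum ι (QW n b) := by
  induction n using Nat.strong_induction_on generalizing b with
  | _ n ih =>
  induction b using Nat.strong_induction_on with
  | _ b ihb =>
  rcases b with _ | b
  · simp [QW_zero]
  rcases n with _ | n
  · simp [QW_zero']
  by_cases h : n = l
  · have hs := φ_JM_add ι k l hkl φ hφ
    have hm := φ_JM_mul ι hι k l hkl φ hφ
    subst h
    have i1 := fun b => ih k (by omega) b (by omega)
    rcases b with _ | b
    · rw [QW_rec, hkl, QW_rec]
      rw [QW_zero, QW_zero, ← hkl, add_assoc, mul_one, mul_one, map_add, hs, i1]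
    · have e1 := QW_rec ι l (b + 1)
      have e2 := QW_rec ι l b
      have e3 := QW_rec ι k (b + 1)
      rw [← hkl] at e3
      have : wsum ι (QW (l + 1) (b + 1 + 1)) = wsum ι (QW k (b + 1 + 1)) +
          (JM ι k + JM ι l) * wsum ι (QW (l + 1) (b + 1)) -
          (JM ι k * JM ι l) * wsum ι (QW (l + 1) b) := by
        rw [e1, e3, e2]; noncomm_ring
      rw [this, map_sub, map_add, map_mul _ (_ + _), map_mul _ (_ * _), hs, hm, i1,
        ihb _ (by omega), ihb _ (by omega)]
  · rw [QW_rec, map_add, map_mul, ih n (by omega) _ h, ihb b (by omega),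
      φ_JM_other ι k l hkl φ hφ n (by omega) h]
end rec
def QM {d : ℕ} (p q b : ℕ) (τ : Fin b → Equiv.Perm (Fin d)) : Prop :=
  (∀ i, (τ i).IsSwap) ∧ MonCond p q τ

theorem QM_snoc {d : ℕ} (p q b : ℕ) (hb : p + q ≤ b) (τ : Fin b → Equiv.Perm (Fin d))
    (x : Equiv.Perm (Fin d)) :
    QM p q (b + 1) (Fin.snoc (α := fun _ => Equiv.Perm (Fin d)) τ x) ↔ x.IsSwap ∧ QM p q b τ := by
  constructor
  · rintro ⟨h1, h2⟩
    refine ⟨by simpa using h1 (Fin.last b), fun i => by simpa using h1 i.castSucc, fun i j hij => ?_⟩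
    simpa using h2 i.castSucc j.castSucc (by simpa using hij)
  · rintro ⟨h1, h3, h4⟩
    refine ⟨fun i => ?_, fun i j hij => ?_⟩
    · induction i using Fin.lastCases <;> simp [h1, h3]
    · induction j using Fin.lastCases with
      | last =>
        simp only [Fin.val_last] at hij
        constructor <;> intros <;> omega
      | cast j =>
        induction i using Fin.lastCases with
        | last => simp at hij; omega
        | cast i => simpa using h4 i j (by simpa using hij)

theorem QM_eq_QS {d : ℕ} (q : ℕ) (τ : Fin q → Equiv.Perm (Fin d)) : QM 0 q q τ ↔ QS d q τ := by
  constructor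
  · rintro ⟨h1, h2⟩
    refine ⟨h1, ?_, fun i => permTop_lt (h1 i)⟩
    cases q with
    | zero => intro i; exact i.elim0
    | succ q =>
      rw [Fin.strictMono_iff_lt_succ]
      intro i
      exact (h2 i.castSucc i.succ (by simp)).2 (by omega) (by simp)
  · rintro ⟨h1, h2, -⟩
    refine ⟨h1, fun i j hij => ⟨fun h => by omega, fun _ _ => h2 (by rw [Fin.lt_def]; omega)⟩⟩

theorem QM_eq_QW {d : ℕ} (q : ℕ) (τ : Fin q → Equiv.Perm (Fin d)) : QM q 0 q τ ↔ QW d q τ := by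
  constructor
  · rintro ⟨h1, h2⟩
    refine ⟨h1, ?_, fun i => permTop_lt (h1 i)⟩
    cases q with
    | zero => intro i; exact i.elim0
    | succ q =>
      rw [Fin.monotone_iff_le_succ]
      intro i
      exact (h2 i.castSucc i.succ (by simp)).1 (by simp)
  · rintro ⟨h1, h2, -⟩
    refine ⟨h1, fun i j hij => ⟨fun _ => h2 (by rw [Fin.le_def]; omega), fun _ h => by omega⟩⟩

theorem φ_QM {d : ℕ} {A : Type*} [Ring A] (ι : Equiv.Perm (Fin d) → A)
    (hι : ∀ x y, ι x * ι y = ι (x * y * x⁻¹) * ι x) (k l : Fin d) (hkl : (l : ℕ) = k + 1)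
    (φ : A →+* A) (hφ : ∀ x, φ (ι x) = ι (Equiv.swap k l * x * (Equiv.swap k l)⁻¹))
    (p q r : ℕ) (hpq : p = 0 ∨ q = 0) :
    φ (wsum ι (QM p q (p + q + r))) = wsum ι (QM p q (p + q + r)) := by
  classical
  induction r with
  | zero =>
    rcases hpq with rfl | rfl
    · have : ∀ b, b = q → φ (wsum ι (QM 0 q b)) = wsum ι (QM 0 q b) := by
        rintro b rfl
        rw [wsum_congr ι (QM_eq_QS b)]
        exact φ_QS ι hι k l hkl φ hφ d b (by omega)
      exact this _ (by omega)
    · simp only [Nat.add_zero]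
      rw [wsum_congr ι (QM_eq_QW p)]
      exact φ_QW ι hι k l hkl φ hφ d p (by omega)
  | succ r ih =>
    have e : wsum ι (QM p q (p + q + (r + 1))) =
        (∑ x : Equiv.Perm (Fin d) with x.IsSwap, ι x) * wsum ι (QM p q (p + q + r)) := by
      rw [← add_assoc, wsum_succ, Finset.sum_filter, Finset.sum_mul]
      refine Finset.sum_congr rfl fun x _ => ?_
      by_cases hx : x.IsSwap
      · rw [if_pos hx]
        congr 1
        exact wsum_congr ι fun τ => by rw [QM_snoc _ _ _ (by omega)]; simp [hx]
      · rw [if_neg hx, wsum_false ι (b := p + q + r)]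
        · simp
        · intro τ; rw [QM_snoc _ _ _ (by omega)]; simp [hx]
    rw [e, map_mul, ih, map_sum]
    congr 1
    simp only [hφ]
    refine Finset.sum_bij' (fun x _ => Equiv.swap k l * x * (Equiv.swap k l)⁻¹)
      (fun x _ => (Equiv.swap k l)⁻¹ * x * Equiv.swap k l) ?_ ?_ ?_ ?_ ?_
    · intro x hx
      simp only [Finset.mem_filter, Finset.mem_univ, true_and] at hx ⊢
      exact isSwap_conj _ _ hx
    · intro x hx
      simp only [Finset.mem_filter, Finset.mem_univ, true_and] at hx ⊢
      simpa using isSwap_conj (Equiv.swap k l)⁻¹ _ hx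
    · intros; group
    · intros; group
    · intros; rfl

/-- Permutations remembering a subgroup. -/
@[ext] structure PS (G : Type*) [Group G] where
  w : G
  H : Subgroup G

instance (G : Type*) [Group G] : Monoid (PS G) where
  mul a b := ⟨a.w * b.w, a.H ⊔ b.H⟩
  one := ⟨1, ⊥⟩
  mul_assoc a b c := PS.ext (mul_assoc _ _ _) (sup_assoc _ _ _)
  one_mul a := PS.ext (one_mul _) (bot_sup_eq _)
  mul_one a := PS.ext (mul_one _) (sup_bot_eq _)

theorem PS.mul_w {G : Type*} [Group G] (a b : PS G) : (a * b).w = a.w * b.w := rfl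
theorem PS.mul_H {G : Type*} [Group G] (a b : PS G) : (a * b).H = a.H ⊔ b.H := rfl
theorem PS.one_w {G : Type*} [Group G] : (1 : PS G).w = 1 := rfl
theorem PS.one_H {G : Type*} [Group G] : (1 : PS G).H = ⊥ := rfl

def PS.conj {G : Type*} [Group G] (g : G) : PS G →* PS G where
  toFun a := ⟨g * a.w * g⁻¹, a.H.map (MulAut.conj g).toMonoidHom⟩
  map_one' := PS.ext (by simp [PS.one_w]) (by simp [PS.one_H])
  map_mul' a b := PS.ext (by simp [PS.mul_w]) (by simp [PS.mul_H, Subgroup.map_sup])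

def PS.inc {G : Type*} [Group G] (x : G) : PS G := ⟨x, Subgroup.closure {x}⟩

theorem PS.conj_inc {G : Type*} [Group G] (g x : G) :
    PS.conj g (PS.inc x) = PS.inc (g * x * g⁻¹) := by
  refine PS.ext rfl ?_
  simp [PS.conj, PS.inc, MonoidHom.map_closure]

theorem PS.inc_mul {G : Type*} [Group G] (x y : G) :
    PS.inc x * PS.inc y = PS.inc (x * y * x⁻¹) * PS.inc x := by
  refine PS.ext (by simp [PS.mul_w, PS.inc]) ?_
  simp only [PS.mul_H, PS.inc]
  have hx : x ∈ Subgroup.closure ({x} : Set G) := Subgroup.subset_closure rfl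
  have hy : y ∈ Subgroup.closure ({y} : Set G) := Subgroup.subset_closure rfl
  have hz : x * y * x⁻¹ ∈ Subgroup.closure ({x * y * x⁻¹} : Set G) := Subgroup.subset_closure rfl
  apply le_antisymm
  · refine sup_le le_sup_right ?_
    rw [Subgroup.closure_le, Set.singleton_subset_iff]
    have h1 := (le_sup_right : _ ≤ Subgroup.closure {x * y * x⁻¹} ⊔ Subgroup.closure {x}) hx
    have h2 := (le_sup_left : _ ≤ Subgroup.closure {x * y * x⁻¹} ⊔ Subgroup.closure {x}) hz
    have := mul_mem (mul_mem (inv_mem h1) h2) h1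
    simpa [mul_assoc] using this
  · refine sup_le ?_ le_sup_left
    rw [Subgroup.closure_le, Set.singleton_subset_iff]
    have h1 := (le_sup_left : _ ≤ Subgroup.closure {x} ⊔ Subgroup.closure {y}) hx
    have h2 := (le_sup_right : _ ≤ Subgroup.closure {x} ⊔ Subgroup.closure {y}) hy
    exact mul_mem (mul_mem h1 h2) (inv_mem h1)

theorem PS.conj_mul {G : Type*} [Group G] (g h : G) :
    PS.conj (g * h) = (PS.conj g).comp (PS.conj h) := by
  ext a
  · simp [PS.conj, mul_assoc]
  · simp [PS.conj, mul_assoc, Subgroup.mem_map]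

theorem PS.conj_one {G : Type*} [Group G] :
    PS.conj (1 : G) = MonoidHom.id _ := by
  ext a
  · simp [PS.conj]
  · simp [PS.conj, Subgroup.mem_map]

theorem PS.conj_injective {G : Type*} [Group G] (g : G) : Function.Injective (PS.conj g) := by
  have : ∀ a, PS.conj g⁻¹ (PS.conj g a) = a := fun a => by
    rw [← MonoidHom.comp_apply, ← PS.conj_mul]; simp [PS.conj_one]
  exact Function.LeftInverse.injective this

noncomputable def PSι {d : ℕ} (x : Equiv.Perm (Fin d)) :
    MonoidAlgebra ℤ (PS (Equiv.Perm (Fin d))) := MonoidAlgebra.of ℤ _ (PS.inc x)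

theorem φ_QM_all {d : ℕ} (p q r : ℕ) (hpq : p = 0 ∨ q = 0) (g : Equiv.Perm (Fin d)) :
    MonoidAlgebra.mapDomainRingHom ℤ (PS.conj g) (wsum PSι (QM p q (p + q + r))) =
      wsum PSι (QM p q (p + q + r)) := by
  cases d with
  | zero =>
    obtain rfl : g = 1 := Subsingleton.elim _ _
    rw [PS.conj_one, MonoidAlgebra.mapDomainRingHom_id]; rfl
  | succ d =>
    have hg : g ∈ Submonoid.closure
        (Set.range fun i : Fin d => Equiv.swap i.castSucc i.succ) := by
      rw [Equiv.Perm.mclosure_swap_castSucc_succ]; trivial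
    induction hg using Submonoid.closure_induction with
    | one => rw [PS.conj_one, MonoidAlgebra.mapDomainRingHom_id]; rfl
    | mul x y _ _ hx hy =>
      rw [PS.conj_mul, MonoidAlgebra.mapDomainRingHom_comp, RingHom.comp_apply, hy, hx]
    | mem x hx =>
      obtain ⟨i, rfl⟩ := hx
      refine φ_QM PSι ?_ i.castSucc i.succ (by simp) _ ?_ p q r hpq
      · intro x y
        simp only [PSι, ← map_mul, PS.inc_mul x y]
      · intro x
        simp [PSι, PS.conj_inc]

/-- The class of a tuple. -/
noncomputable def NN {d b : ℕ} (τ : Fin b → Equiv.Perm (Fin d)) : PS (Equiv.Perm (Fin d)) :=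
  (List.ofFn fun i => PS.inc (τ i)).reverse.prod

theorem NN_w {d b : ℕ} (τ : Fin b → Equiv.Perm (Fin d)) :
    (NN τ).w = (List.ofFn τ).reverse.prod := by
  let f : PS (Equiv.Perm (Fin d)) →* Equiv.Perm (Fin d) := ⟨⟨PS.w, rfl⟩, fun _ _ => rfl⟩
  change f (NN τ) = _
  rw [NN, map_list_prod, List.map_reverse, List.map_ofFn]
  rfl

theorem NN_H {d b : ℕ} (τ : Fin b → Equiv.Perm (Fin d)) :
    (NN τ).H = Subgroup.closure (Set.range τ) := by
  induction b with
  | zero => simp [NN, PS.one_H]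
  | succ b ih =>
    have h2 := ih (fun i => τ i.castSucc)
    have h3 : Set.range τ = insert (τ (Fin.last b)) (Set.range fun i : Fin b => τ i.castSucc) := by
      ext x
      simp [Fin.exists_fin_succ', or_comm, eq_comm]
    rw [NN, List.ofFn_succ']
    simp only [List.concat_eq_append, List.reverse_append, List.reverse_cons, List.reverse_nil,
      List.nil_append, List.singleton_append, List.prod_cons, PS.mul_H]
    rw [NN] at h2
    rw [h2, h3, Set.insert_eq, Subgroup.closure_union]
    rfl

theorem wsum_PSι {d b : ℕ} (Q : (Fin b → Equiv.Perm (Fin d)) → Prop) (a : PS (Equiv.Perm (Fin d))) :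
    (wsum PSι Q).coeff a = (Nat.card {τ // Q τ ∧ NN τ = a} : ℤ) := by
  classical
  rw [Nat.card_eq_fintype_card, Fintype.card_subtype]
  rw [Finset.card_filter]
  simp only [wsum]
  have : ∀ τ : Fin b → Equiv.Perm (Fin d), (List.ofFn fun i => PSι (τ i)).reverse.prod
      = MonoidAlgebra.single (NN τ) (1 : ℤ) := by
    intro τ
    rw [← MonoidAlgebra.of_apply, NN, map_list_prod, List.map_reverse, List.map_ofFn]
    rfl
  simp only [this]
  have h : ∀ s : Finset (Fin b → Equiv.Perm (Fin d)), 
    ∀ f : (Fin b → Equiv.Perm (Fin d)) → MonoidAlgebra ℤ (PS (Equiv.Perm (Fin d))),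
    (∑ i ∈ s, f i).coeff a = ∑ i ∈ s, (f i).coeff a := by
    intro s f
    induction s using Finset.induction_on with
    | empty => simp
    | insert x s hx ih => rw [Finset.sum_insert hx, Finset.sum_insert hx, ← ih]; simp
  rw [h]
  push_cast
  refine Finset.sum_congr rfl fun τ _ => ?_
  by_cases hq : Q τ
  · simp [hq, Finsupp.single_apply]
  · simp [hq]

theorem card_fiber {d : ℕ} (p q r : ℕ) (hpq : p = 0 ∨ q = 0) (g : Equiv.Perm (Fin d))
    (a : PS (Equiv.Perm (Fin d))) :
    Nat.card {τ // QM p q (p + q + r) τ ∧ NN τ = a} =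
      Nat.card {τ // QM p q (p + q + r) τ ∧ NN τ = PS.conj g a} := by
  have h := φ_QM_all p q r hpq g
  have := wsum_PSι (QM p q (p + q + r)) (PS.conj g a)
  rw [← h] at this
  have e := wsum_PSι (QM p q (p + q + r)) a
  zify
  rw [← e, ← this]
  change _ = (MonoidAlgebra.mapDomain _ _).coeff _
  rw [MonoidAlgebra.coeff_mapDomain, Finsupp.mapDomain_apply (PS.conj_injective g)]

theorem exists_equiv {d : ℕ} (p q r : ℕ) (hpq : p = 0 ∨ q = 0) (g : Equiv.Perm (Fin d)) :
    ∃ f : (Fin (p + q + r) → Equiv.Perm (Fin d)) → (Fin (p + q + r) → Equiv.Perm (Fin d)),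
      ∀ τ, QM p q _ τ → QM p q _ (f τ) ∧ NN (f τ) = PS.conj g (NN τ) ∧
        ∀ τ', QM p q _ τ' → f τ = f τ' → τ = τ' := by
  classical
  have h : ∀ a, Nonempty ({τ // QM p q (p + q + r) τ ∧ NN τ = a} ≃
      {τ // QM p q (p + q + r) τ ∧ NN τ = PS.conj g a}) := fun a =>
    ⟨(Finite.equivFin _).trans ((finCongr (card_fiber p q r hpq g a)).trans
      (Finite.equivFin _).symm)⟩
  let F := fun a => (h a).some
  refine ⟨fun τ => if hτ : QM p q _ τ then (F (NN τ) ⟨τ, hτ, rfl⟩).1 else τ, fun τ hτ => ?_⟩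
  simp only [dif_pos hτ]
  refine ⟨(F (NN τ) ⟨τ, hτ, rfl⟩).2.1, (F (NN τ) ⟨τ, hτ, rfl⟩).2.2, fun τ' hτ' e => ?_⟩
  simp only [dif_pos hτ'] at e
  have key : NN τ = NN τ' := by
    apply PS.conj_injective g
    rw [← (F (NN τ) ⟨τ, hτ, rfl⟩).2.2, ← (F (NN τ') ⟨τ', hτ', rfl⟩).2.2, e]
  have aux : ∀ a b (ha : NN τ = a) (hb : NN τ' = b), a = b →
      (F a ⟨τ, hτ, ha⟩).1 = (F b ⟨τ', hτ', hb⟩).1 → τ = τ' := by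
    rintro a b ha hb rfl e
    have := (F a).injective (Subtype.ext e)
    exact congrArg Subtype.val this
  exact aux _ _ rfl rfl key e
theorem listing_conj {d n : ℕ} (σ g : Equiv.Perm (Fin d)) (ν : Fin n → ℕ)
    (B : Fin n → Set (Fin d)) (h : IsOrbitListing σ ν B) :
    IsOrbitListing (g * σ * g⁻¹) ν (fun j => g '' B j) := by
  obtain ⟨h1, h2, h3, h4⟩ := h
  refine ⟨fun j => ?_, fun i j hij => h2 (g.injective.image_injective hij), fun x => ?_, fun j => ?_⟩
  · obtain ⟨x, hx⟩ := h1 j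
    refine ⟨g x, ?_⟩
    ext y
    beta_reduce
    rw [hx, Equiv.image_eq_preimage_symm]
    simp only [Set.mem_preimage, Set.mem_ofPred_eq, Equiv.Perm.sameCycle_conj]
    simp
  · obtain ⟨j, hj⟩ := h3 (g⁻¹ x)
    exact ⟨j, g⁻¹ x, hj, by simp⟩
  · rw [Set.ncard_image_of_injective _ g.injective, h4]

theorem trans_iff {d b : ℕ} (σ σ₂ : Equiv.Perm (Fin d)) (τ : Fin b → Equiv.Perm (Fin d)) :
    Subgroup.closure ({σ, σ₂} ∪ Set.range τ : Set (Equiv.Perm (Fin d))) =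
      Subgroup.closure {σ, σ₂} ⊔ (NN τ).H := by
  rw [Subgroup.closure_union, NN_H]

theorem Mcount_le {d n p q r : ℕ} (hpq : p = 0 ∨ q = 0) (ν : Fin n → ℕ)
    (σ g : Equiv.Perm (Fin d)) : Mcount d n p q r ν σ ≤ Mcount d n p q r ν (g * σ * g⁻¹) := by
  obtain ⟨f, hf⟩ := exists_equiv (d := d) p q r hpq g
  unfold Mcount
  refine Nat.card_le_card_of_injective
    (fun t => ⟨(f t.1.1, g * t.1.2.1 * g⁻¹, fun j => g '' t.1.2.2 j), ?_⟩) ?_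
  · obtain ⟨⟨τ, σ₂, B⟩, h1, h2, h3, h4, h5⟩ := t
    dsimp only at h1 h2 h3 h4 h5 ⊢
    obtain ⟨e1, e2, -⟩ := hf τ ⟨h1, h2⟩
    refine ⟨e1.1, e1.2, ?_, ?_, listing_conj _ _ _ _ h5⟩
    · rw [← NN_w] at h3 ⊢
      rw [e2]
      change g * σ₂ * g⁻¹ * (g * (NN τ).w * g⁻¹) * (g * σ * g⁻¹) = 1
      calc _ = g * (σ₂ * (NN τ).w * σ) * g⁻¹ := by group
        _ = 1 := by rw [h3]; group
    · intro x y
      rw [trans_iff] at h4 ⊢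
      obtain ⟨k, hk, hxy⟩ := h4 (g⁻¹ x) (g⁻¹ y)
      refine ⟨g * k * g⁻¹, ?_, by rw [Equiv.Perm.mul_apply, Equiv.Perm.mul_apply, hxy]; simp⟩
      have e : Subgroup.closure {g * σ * g⁻¹, g * σ₂ * g⁻¹} ⊔ (NN (f τ)).H =
          (Subgroup.closure {σ, σ₂} ⊔ (NN τ).H).map (MulAut.conj g).toMonoidHom := by
        rw [e2, Subgroup.map_sup, MonoidHom.map_closure, Set.image_pair]
        rfl
      rw [e]
      exact ⟨k, hk, rfl⟩
  · rintro ⟨⟨τ, σ₂, B⟩, h1, h2, h3, h4, h5⟩ ⟨⟨τ', σ₂', B'⟩, h1', h2', h3', h4', h5'⟩ h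
    simp only [Subtype.mk.injEq, Prod.mk.injEq] at h ⊢
    obtain ⟨a1, a2, a3⟩ := h
    refine ⟨(hf τ ⟨h1, h2⟩).2.2 τ' ⟨h1', h2'⟩ a1, by simpa using a2, ?_⟩
    funext j
    exact g.injective.image_injective (congrFun a3 j)

theorem Mcount_conj {d n p q r : ℕ} (hpq : p = 0 ∨ q = 0) (ν : Fin n → ℕ)
    (σ g : Equiv.Perm (Fin d)) : Mcount d n p q r ν (g * σ * g⁻¹) = Mcount d n p q r ν σ := by
  refine le_antisymm ?_ (Mcount_le hpq ν σ g)
  have := Mcount_le (r := r) hpq ν (g * σ * g⁻¹) g⁻¹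
  have e : g⁻¹ * (g * σ * g⁻¹) * g⁻¹⁻¹ = σ := by group
  rwa [e] at this

theorem rot_val (n : ℕ) (j : Fin n) : (finRotate n j : ℕ) = (j + 1) % n := by
  cases n with
  | zero => exact j.elim0
  | succ n => rw [finRotate_apply, Fin.val_add]; simp

section blocks
variable {d m : ℕ} {μ : Fin m → ℕ}

def pe (e : (Σ i : Fin m, Fin (μ i)) ≃ Fin d) : Equiv.Perm (Fin d) :=
  e.permCongr (Equiv.sigmaCongrRight fun i => finRotate (μ i))

theorem pe_apply (e : (Σ i : Fin m, Fin (μ i)) ≃ Fin d) (i : Fin m) (j : Fin (μ i)) :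
    pe e (e ⟨i, j⟩) = e ⟨i, finRotate (μ i) j⟩ := by
  simp [pe]

theorem pe_pow (e : (Σ i : Fin m, Fin (μ i)) ≃ Fin d) (i : Fin m) (j : Fin (μ i)) (t : ℕ) :
    (pe e ^ t) (e ⟨i, j⟩) = e ⟨i, ⟨(j + t) % μ i, Nat.mod_lt _ (by have := j.2; omega)⟩⟩ := by
  induction t with
  | zero =>
    simp only [pow_zero, Equiv.Perm.one_apply]
    congr 2
    exact Fin.ext (by simp [Nat.mod_eq_of_lt j.2])
  | succ t ih =>
    rw [pow_succ', Equiv.Perm.mul_apply, ih, pe_apply]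
    congr 2
    exact Fin.ext (by rw [rot_val]; simp [Nat.add_assoc])

theorem pe_sameCycle (e : (Σ i : Fin m, Fin (μ i)) ≃ Fin d) (i : Fin m) (j : Fin (μ i)) (y : Fin d) :
    (pe e).SameCycle (e ⟨i, j⟩) y ↔ (e.symm y).1 = i := by
  constructor
  · intro h
    obtain ⟨t, -, ht⟩ := h.exists_pow_eq'
    rw [← ht, pe_pow]; simp
  · intro h
    obtain ⟨⟨i', j'⟩, rfl⟩ := e.surjective y
    simp at h
    subst h
    refine ⟨((j' + (μ i' - j) : ℕ) : ℤ), ?_⟩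
    rw [zpow_natCast, pe_pow]
    congr 2
    refine Fin.ext ?_
    have := j.2
    have e : (j : ℕ) + (j' + (μ i' - j)) = j' + μ i' := by omega
    simp [e, Nat.mod_eq_of_lt j'.2]

theorem pe_listing (hμ : ∀ i, 0 < μ i) (e : (Σ i : Fin m, Fin (μ i)) ≃ Fin d) :
    IsOrbitListing (pe e) μ (fun i => {y | (e.symm y).1 = i}) := by
  refine ⟨fun i => ⟨e ⟨i, ⟨0, hμ i⟩⟩, ?_⟩, fun i i' h => ?_, fun x => ⟨_, rfl⟩, fun i => ?_⟩
  · ext y; simp [pe_sameCycle]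
  · have : e ⟨i, ⟨0, hμ i⟩⟩ ∈ {y | (e.symm y).1 = i'} := by
      dsimp only at h
      rw [← h]; simp
    simpa using this
  · have : {y | (e.symm y).1 = i} = Set.range (fun j : Fin (μ i) => e ⟨i, j⟩) := by
      ext y
      obtain ⟨⟨i', j'⟩, rfl⟩ := e.surjective y
      simp only [Set.mem_ofPred_eq, Equiv.symm_apply_apply, Set.mem_range, EmbeddingLike.apply_eq_iff_eq]
      constructor
      · rintro rfl; exact ⟨j', rfl⟩
      · rintro ⟨j, hj⟩; exact (congrArg Sigma.fst hj).symm
    beta_reduce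
    rw [this, ← Set.image_univ, Set.ncard_image_of_injective, Set.ncard_univ]
    · simp
    · intro j j' h
      have := e.injective h
      simpa using this

theorem exists_e (hμsum : ∑ i, μ i = d) (hμ : ∀ i, 0 < μ i) (σ : Equiv.Perm (Fin d))
    (A : Fin m → Set (Fin d)) (h : IsOrbitListing σ μ A) (x : Fin m → Fin d) (hx : ∀ i, x i ∈ A i) :
    ∃ e : (Σ i : Fin m, Fin (μ i)) ≃ Fin d, pe e = σ ∧ (fun i => {y | (e.symm y).1 = i}) = A ∧
      (fun i => e ⟨i, ⟨0, hμ i⟩⟩) = x := by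
  classical
  obtain ⟨h1, h2, h3, h4⟩ := h
  have hA : ∀ i y, y ∈ A i → A i = {z | σ.SameCycle y z} := by
    intro i y hy
    obtain ⟨u, hu⟩ := h1 i
    rw [hu] at hy ⊢
    ext z
    exact ⟨fun hz => (Equiv.Perm.SameCycle.symm hy).trans hz, fun hz => Equiv.Perm.SameCycle.trans hy hz⟩
  have hmem : ∀ i (t : ℕ), (σ ^ t) (x i) ∈ A i := by
    intro i t
    rw [hA i _ (hx i)]
    exact ⟨t, by simp⟩
  have huniq : ∀ i i' y, y ∈ A i → y ∈ A i' → i = i' := by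
    intro i i' y hy hy'
    exact h2 ((hA i y hy).trans (hA i' y hy').symm)
  have hper : ∀ i, Function.minimalPeriod σ (x i) = μ i := by
    intro i
    have e1 := MulAction.minimalPeriod_eq_card (a := σ) (b := x i)
    have e2 : MulAction.orbit (Subgroup.zpowers σ) (x i) = A i := by
      rw [hA i _ (hx i)]
      ext y
      constructor
      · rintro ⟨⟨_, ⟨k, rfl⟩⟩, rfl⟩
        exact ⟨k, rfl⟩
      · rintro ⟨k, rfl⟩
        exact ⟨⟨_, ⟨k, rfl⟩⟩, rfl⟩
    rw [← Nat.card_eq_fintype_card, e2, Nat.card_coe_set_eq, h4] at e1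
    exact e1
  have hpow : ∀ (t : ℕ) y, (σ ^ t) y = σ^[t] y := fun t y => by
    rw [Equiv.Perm.iterate_eq_pow]
  let F : (Σ i : Fin m, Fin (μ i)) → Fin d := fun s => (σ ^ (s.2 : ℕ)) (x s.1)
  have hF : Function.Bijective F := by
    rw [Fintype.bijective_iff_injective_and_card]
    refine ⟨?_, by simp [hμsum]⟩
    rintro ⟨i, j⟩ ⟨i', j'⟩ hij
    obtain rfl : i = i' := huniq i i' _ (hmem i j) (by
      have := hmem i' j'
      simp only [F] at hij
      rwa [← hij] at this)
    simp only [F, hpow] at hij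
    have := Function.iterate_injOn_Iio_minimalPeriod (f := σ) (x := x i)
      (by rw [Set.mem_Iio, hper]; exact j.2) (by rw [Set.mem_Iio, hper]; exact j'.2) hij
    rw [Fin.ext this]
  refine ⟨Equiv.ofBijective F hF, ?_, ?_, ?_⟩
  · ext1 y
    obtain ⟨⟨i, j⟩, rfl⟩ := (Equiv.ofBijective F hF).surjective y
    rw [pe_apply]
    simp only [Equiv.ofBijective_apply, F]
    rw [rot_val, ← Equiv.Perm.mul_apply, ← pow_succ', hpow, hpow]
    have hm := Function.iterate_mod_minimalPeriod_eq (f := σ) (x := x i) (n := (j : ℕ) + 1)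
    rwa [hper] at hm
  · funext i
    ext y
    obtain ⟨⟨i', j⟩, rfl⟩ := (Equiv.ofBijective F hF).surjective y
    simp only [Set.mem_ofPred_eq, Equiv.symm_apply_apply]
    constructor
    · rintro rfl; exact hmem _ _
    · intro hy; exact huniq _ _ _ (hmem _ _) hy
  · funext i
    simp [F]

theorem card_X (hμsum : ∑ i, μ i = d) (hμ : ∀ i, 0 < μ i) :
    Nat.card {x : Equiv.Perm (Fin d) × (Fin m → Set (Fin d)) // IsOrbitListing x.1 μ x.2} *
      ∏ i, μ i = d.factorial := by
  let X := {x : Equiv.Perm (Fin d) × (Fin m → Set (Fin d)) // IsOrbitListing x.1 μ x.2}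
  let Z := {z : (Equiv.Perm (Fin d) × (Fin m → Set (Fin d))) × (Fin m → Fin d) //
    IsOrbitListing z.1.1 μ z.1.2 ∧ ∀ i, z.2 i ∈ z.1.2 i}
  have c1 : Nat.card Z = Nat.card X * ∏ i, μ i := by
    let E : Z ≃ Σ x : X, ∀ i, x.1.2 i :=
      ⟨fun z => ⟨⟨z.1.1, z.2.1⟩, fun i => ⟨z.1.2 i, z.2.2 i⟩⟩,
       fun s => ⟨(s.1.1, fun i => s.2 i), s.1.2, fun i => (s.2 i).2⟩, fun _ => rfl, fun _ => rfl⟩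
    classical
    have := Fintype.ofFinite X
    rw [Nat.card_congr E, Nat.card_sigma]
    have : ∀ x : X, Nat.card (∀ i, x.1.2 i) = ∏ i, μ i := fun x => by
      rw [Nat.card_pi]
      exact Finset.prod_congr rfl fun i _ => by rw [Nat.card_coe_set_eq, x.2.2.2.2 i]
    rw [Finset.sum_congr rfl fun x _ => this x]
    simp
  have c2 : Nat.card ((Σ i : Fin m, Fin (μ i)) ≃ Fin d) = Nat.card Z := by
    refine Nat.card_congr (Equiv.ofBijective
      (fun e => ⟨((pe e, fun i => {y | (e.symm y).1 = i}), fun i => e ⟨i, ⟨0, hμ i⟩⟩),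
        pe_listing hμ e, fun i => by simp⟩) ⟨?_, ?_⟩)
    · intro e e' h
      have h := congrArg Subtype.val h
      simp only [Prod.mk.injEq] at h
      ext1 ⟨i, j⟩
      have a := pe_pow e i ⟨0, hμ i⟩ j
      have a' := pe_pow e' i ⟨0, hμ i⟩ j
      rw [← h.1.1, ← congrFun h.2 i, a] at a'
      simpa [Nat.mod_eq_of_lt j.2] using a'
    · rintro ⟨⟨⟨σ, A⟩, x⟩, h1, h2⟩
      obtain ⟨e, a1, a2, a3⟩ := exists_e hμsum hμ σ A h1 x h2
      exact ⟨e, Subtype.ext (Prod.ext (Prod.ext a1 a2) a3)⟩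
  have c3 : Nat.card ((Σ i : Fin m, Fin (μ i)) ≃ Fin d) = d.factorial := by
    classical
    have e0 : (Σ i : Fin m, Fin (μ i)) ≃ Fin d := finSigmaFinEquiv.trans (finCongr hμsum)
    rw [Nat.card_eq_fintype_card, Fintype.card_equiv e0]
    simp [hμsum]
  rw [← c1, ← c2, c3]

theorem partialSum_succ (i : Fin m) : partialSum μ (i + 1) = partialSum μ i + μ i := by
  unfold partialSum
  have : ∀ k : Fin m, (if (k : ℕ) < i + 1 then μ k else 0) =
      (if (k : ℕ) < i then μ k else 0) + if k = i then μ k else 0 := by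
    intro k
    have : k = i ↔ (k : ℕ) = i := Fin.ext_iff
    split_ifs <;> omega
  rw [Finset.sum_congr rfl fun k _ => this k, Finset.sum_add_distrib]
  simp

theorem partialSum_eq (i : ℕ) (hi : i ≤ m) :
    ∑ k : Fin i, μ (Fin.castLE hi k) = partialSum μ i := by
  induction i with
  | zero => simp [partialSum]
  | succ i ih =>
    rw [Fin.sum_univ_castSucc]
    have := partialSum_succ (μ := μ) ⟨i, hi⟩
    simp only at this
    rw [this, ← ih (by omega)]
    rfl

theorem σμ_eq (hμsum : ∑ i, μ i = d) (σμ : Equiv.Perm (Fin d)) (h : IsBlockCyclePerm μ σμ) :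
    pe ((finSigmaFinEquiv (n := μ)).trans (finCongr hμsum)) = σμ := by
  have hv : ∀ i j, (((finSigmaFinEquiv (n := μ)).trans (finCongr hμsum)) ⟨i, j⟩ : ℕ) =
      partialSum μ i + j := by
    intro i j
    simp [finSigmaFinEquiv_apply, partialSum_eq]
  ext1 y
  obtain ⟨⟨i, j⟩, rfl⟩ := ((finSigmaFinEquiv (n := μ)).trans (finCongr hμsum)).surjective y
  rw [pe_apply]
  refine Fin.ext ?_
  rw [hv, rot_val]
  have hs := partialSum_succ (μ := μ) i
  have hj := j.2
  by_cases hc : (j : ℕ) + 1 < μ i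
  · rw [h.1 _ i (by rw [hv]; omega) (by rw [hv]; omega), hv, Nat.mod_eq_of_lt hc, add_assoc]
  · have : (j : ℕ) + 1 = μ i := by omega
    rw [h.2 _ i (by rw [hv]; omega), this, Nat.mod_self, add_zero]
end blocks

/-- The number `F` of tuples `(σ₁, (A₁,…,A_m), τ₁,…,τ_b, σ₂, (B₁,…,B_n))` —
with `σ₁, σ₂ ∈ S_d`, each `τᵢ` a transposition, `(τ₁,…,τ_b)` satisfying the
`(p,q)`-monotonicity condition, `σ₂·τ_b⋯τ₁·σ₁ = id`, the generated subgroup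
transitive, `(A₁,…,A_m)` an ordered list of the orbits of `σ₁` with `|A_i| = μ_i`,
and `(B₁,…,B_n)` an ordered list of the orbits of `σ₂` with `|B_j| = ν_j` —
equals `(d!/(μ₁⋯μ_m)) · M_{p,q,r;μ,ν}`. -/
theorem labelled_count_eq_fixed_first_count
    (d m n p q r gen : ℕ) (hd : 0 < d)
    (μ : Fin m → ℕ) (ν : Fin n → ℕ)
    (hμ : ∀ i, 0 < μ i) (hν : ∀ j, 0 < ν j)
    (hμsum : ∑ i, μ i = d) (hνsum : ∑ j, ν j = d)
    (hpq : p = 0 ∨ q = 0)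
    (hb : p + q + r + 2 = 2 * gen + m + n)
    (σμ : Equiv.Perm (Fin d)) (hσμ : IsBlockCyclePerm μ σμ) :
    (Nat.card { t : Equiv.Perm (Fin d) × (Fin m → Set (Fin d)) ×
        (Fin (p + q + r) → Equiv.Perm (Fin d)) × Equiv.Perm (Fin d) ×
        (Fin n → Set (Fin d)) //
      (∀ i, (t.2.2.1 i).IsSwap) ∧ MonCond p q t.2.2.1 ∧
      t.2.2.2.1 * (List.ofFn t.2.2.1).reverse.prod * t.1 = 1 ∧
      (∀ x y : Fin d, ∃ g ∈ Subgroup.closure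
          ({t.1, t.2.2.2.1} ∪ Set.range t.2.2.1 : Set (Equiv.Perm (Fin d))), g x = y) ∧
      IsOrbitListing t.1 μ t.2.1 ∧
      IsOrbitListing t.2.2.2.1 ν t.2.2.2.2 } : ℚ) =
    ((d.factorial : ℚ) / ∏ i, (μ i : ℚ)) * (Mcount d n p q r ν σμ : ℚ) := by
  let X := {x : Equiv.Perm (Fin d) × (Fin m → Set (Fin d)) // IsOrbitListing x.1 μ x.2}
  have hX : ∀ x : X, Mcount d n p q r ν x.1.1 = Mcount d n p q r ν σμ := by
    rintro ⟨⟨σ, A⟩, hA⟩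
    have : ∀ i, ∃ y, y ∈ A i := fun i => by
      obtain ⟨u, hu⟩ := hA.1 i
      dsimp only at hu
      exact ⟨u, by rw [hu]; exact Equiv.Perm.SameCycle.refl _ _⟩
    choose x hx using this
    obtain ⟨e, he, -, -⟩ := exists_e hμsum hμ σ A hA x hx
    have h0 := σμ_eq hμsum σμ hσμ
    set e0 := (finSigmaFinEquiv (n := μ)).trans (finCongr hμsum)
    let g : Equiv.Perm (Fin d) := e0.symm.trans e
    have hg : σ = g * σμ * g⁻¹ := by
      rw [← he, ← h0, eq_mul_inv_iff_mul_eq]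
      ext1 y
      obtain ⟨⟨i, j⟩, rfl⟩ := e0.surjective y
      simp only [Equiv.Perm.mul_apply, pe_apply]
      simp [g, pe_apply]
    dsimp only
    rw [hg, Mcount_conj hpq]
  have key : Nat.card { t : Equiv.Perm (Fin d) × (Fin m → Set (Fin d)) ×
        (Fin (p + q + r) → Equiv.Perm (Fin d)) × Equiv.Perm (Fin d) ×
        (Fin n → Set (Fin d)) //
      (∀ i, (t.2.2.1 i).IsSwap) ∧ MonCond p q t.2.2.1 ∧
      t.2.2.2.1 * (List.ofFn t.2.2.1).reverse.prod * t.1 = 1 ∧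
      (∀ x y : Fin d, ∃ g ∈ Subgroup.closure
          ({t.1, t.2.2.2.1} ∪ Set.range t.2.2.1 : Set (Equiv.Perm (Fin d))), g x = y) ∧
      IsOrbitListing t.1 μ t.2.1 ∧
      IsOrbitListing t.2.2.2.1 ν t.2.2.2.2 } = Nat.card X * Mcount d n p q r ν σμ := by
    classical
    have := Fintype.ofFinite X
    have hs : ∑ x : X, Mcount d n p q r ν x.1.1 = Nat.card X * Mcount d n p q r ν σμ := by
      simp [hX]
    rw [← hs]
    unfold Mcount
    rw [← Nat.card_sigma]
    exact Nat.card_congr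
      ⟨fun t => ⟨⟨(t.1.1, t.1.2.1), t.2.2.2.2.2.1⟩,
          ⟨t.1.2.2, t.2.1, t.2.2.1, t.2.2.2.1, t.2.2.2.2.1, t.2.2.2.2.2.2⟩⟩,
        fun s => ⟨(s.1.1.1, s.1.1.2, s.2.1), s.2.2.1, s.2.2.2.1, s.2.2.2.2.1, s.2.2.2.2.2.1,
          s.1.2, s.2.2.2.2.2.2⟩, fun _ => rfl, fun _ => rfl⟩
  rw [key, ← card_X hμsum hμ]
  have hp : (∏ i, (μ i : ℚ)) ≠ 0 := Finset.prod_ne_zero_iff.2 fun i _ => by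
    have := hμ i
    positivity
  push_cast
  rw [mul_div_assoc, div_self hp, mul_one]
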